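/- Let p be a real number with 1 ≤ p < 4. Then there exists a positive constant C, depending only on p, such that for every smooth compactly supported function f : ℝ⁴ → ℝ one has sup_{x ∈ ℝ⁴} ( ∫_{ℝ⁴} |x − y|^{−p} |f(y)|^p dy )^{1/p} ≤ C ( ‖∇f‖_{L^p(ℝ⁴)} + ‖f‖_{L^p(ℝ⁴)} ), where ∇f denotes the (Fréchet) derivative of f and ‖∇f‖_{L^p} = ( ∫_{ℝ⁴} ‖∇f(y)‖^p dy )^{1/p}. -/

import Mathlib

open MeasureTheory
open Set Module
open scoped ENNReal NNReal

/-- The value at `x` of a compactly supported `C¹` function on `ℝ` is controlled by its derivative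
on the right of `x`. -/
lemma HasCompactSupport.enorm_le_lintegral_Ioi_deriv {F : Type*} [NormedAddCommGroup F]
    [NormedSpace ℝ F] {f : ℝ → F} (hf : ContDiff ℝ 1 f) (h'f : HasCompactSupport f) (x : ℝ) :
    ‖f x‖ₑ ≤ ∫⁻ t in Ioi x, ‖deriv f t‖ₑ := by
  have h := HasCompactSupport.enorm_le_lintegral_Ici_deriv (f := fun t => f (-t))
    (hf.comp contDiff_neg) (h'f.comp_homeomorph (Homeomorph.neg ℝ)) (-x)
  simp only [neg_neg, deriv_comp_neg, enorm_neg] at h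
  refine h.trans_eq ?_
  rw [setLIntegral_congr Ioi_ae_eq_Ici,
    ← (Measure.measurePreserving_neg (volume : Measure ℝ)).setLIntegral_comp_preimage_emb
      (MeasurableEquiv.neg ℝ).measurableEmbedding (fun t => ‖deriv f t‖ₑ) (Ici x)]
  simp

/-- A compactly supported `C¹` function is controlled by its derivative along the outward ray. -/
lemma HasCompactSupport.enorm_le_lintegral_fderiv_smul {E F : Type*} [NormedAddCommGroup E]
    [NormedSpace ℝ E] [NormedAddCommGroup F] [NormedSpace ℝ F] {f : E → F}
    (hf : ContDiff ℝ 1 f) (h'f : HasCompactSupport f) {y : E} (hy : y ≠ 0) :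
    ‖f y‖ₑ ≤ ‖y‖ₑ * ∫⁻ t in Ioi (1 : ℝ), ‖fderiv ℝ f (t • y)‖ₑ := by
  have hsupp : HasCompactSupport fun t : ℝ => f (t • y) :=
    h'f.comp_isClosedEmbedding (isClosedEmbedding_smul_left hy)
  have hsmooth : ContDiff ℝ 1 fun t : ℝ => f (t • y) :=
    hf.comp (contDiff_id.smul contDiff_const)
  have h := hsupp.enorm_le_lintegral_Ioi_deriv hsmooth 1
  rw [one_smul] at h
  rw [← lintegral_const_mul' _ _ enorm_ne_top]
  refine h.trans (lintegral_mono fun t => ?_)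
  have hd : HasDerivAt (fun t : ℝ => f (t • y)) (fderiv ℝ f (t • y) y) t := by
    have := ((hf.differentiable one_ne_zero (t • y)).hasFDerivAt).comp_hasDerivAt t
      ((hasDerivAt_id t).smul_const y)
    simpa [Function.comp_def] using this
  rw [hd.deriv, mul_comm]
  exact (fderiv ℝ f (t • y)).le_opENorm y

/-- Jensen's inequality for the measure of density `w`, in terms of the original measure. -/
lemma ENNReal.rpow_lintegral_le_lintegral_weight_mul {α : Type*} [MeasurableSpace α]
    {μ : Measure α} {p : ℝ} (hp : 1 ≤ p) {w g : α → ℝ≥0∞} (hw : Measurable w)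
    (hg : Measurable g) (hw0 : ∀ᵐ a ∂μ, w a ≠ 0) (hwtop : ∀ᵐ a ∂μ, w a ≠ ∞) :
    (∫⁻ a, g a ∂μ) ^ p ≤ (∫⁻ a, w a ∂μ) ^ (p - 1) * ∫⁻ a, w a ^ (1 - p) * g a ^ p ∂μ := by
  have hp0 : 0 < p := by linarith
  have hm : Measurable fun a => (w a)⁻¹ * g a := hw.inv.mul hg
  have h := eLpNorm'_le_eLpNorm'_mul_rpow_measure_univ one_pos hp
    (μ := μ.withDensity w) hm.aestronglyMeasurable
  simp only [eLpNorm'_eq_lintegral_enorm, enorm_eq_self, ENNReal.rpow_one, div_one] at h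
  rw [lintegral_withDensity_eq_lintegral_mul _ hw hm,
    lintegral_withDensity_eq_lintegral_mul _ hw (hm.pow_const p),
    withDensity_apply _ MeasurableSet.univ, Measure.restrict_univ] at h
  have h₁ : ∫⁻ a, (w * fun a => (w a)⁻¹ * g a) a ∂μ = ∫⁻ a, g a ∂μ := by
    refine lintegral_congr_ae ?_
    filter_upwards [hw0, hwtop] with a h0 ht
    simp [← mul_assoc, ENNReal.mul_inv_cancel h0 ht]
  have h₂ : ∫⁻ a, (w * fun a => ((w a)⁻¹ * g a) ^ p) a ∂μ =
      ∫⁻ a, w a ^ (1 - p) * g a ^ p ∂μ := by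
    refine lintegral_congr_ae ?_
    filter_upwards [hw0, hwtop] with a h0 ht
    rw [Pi.mul_apply, ENNReal.mul_rpow_of_nonneg _ _ hp0.le, ← mul_assoc, ENNReal.inv_rpow,
      ENNReal.rpow_sub _ _ h0 ht, ENNReal.rpow_one, div_eq_mul_inv]
  rw [h₁, h₂] at h
  calc (∫⁻ a, g a ∂μ) ^ p
      ≤ ((∫⁻ a, w a ^ (1 - p) * g a ^ p ∂μ) ^ (1 / p) *
          (∫⁻ a, w a ∂μ) ^ (1 - 1 / p)) ^ p := ENNReal.rpow_le_rpow h hp0.le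
    _ = _ := by
      rw [ENNReal.mul_rpow_of_nonneg _ _ hp0.le, ← ENNReal.rpow_mul, ← ENNReal.rpow_mul,
        one_div_mul_cancel hp0.ne', ENNReal.rpow_one, sub_mul, one_mul,
        one_div_mul_cancel hp0.ne', mul_comm]

lemma lintegral_ofReal_rpow_Ioi_lt_top {a : ℝ} (ha : a < -1) :
    ∫⁻ t in Ioi (1 : ℝ), ENNReal.ofReal (t ^ a) < ∞ :=
  (integrableOn_Ioi_rpow_of_lt ha one_pos).lintegral_lt_top

section

variable {E : Type*} [NormedAddCommGroup E] [NormedSpace ℝ E] [FiniteDimensional ℝ E]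
  [MeasurableSpace E] [BorelSpace E] (μ : Measure E) [μ.IsAddHaarMeasure]

lemma MeasureTheory.Measure.lintegral_addHaar_comp_smul {g : E → ℝ≥0∞} (hg : Measurable g)
    {r : ℝ} (hr : r ≠ 0) :
    ∫⁻ y, g (r • y) ∂μ = ENNReal.ofReal |(r ^ finrank ℝ E)⁻¹| * ∫⁻ y, g y ∂μ := by
  rw [← lintegral_map hg (measurable_const_smul r), map_addHaar_smul μ hr, lintegral_smul_measure,
    smul_eq_mul]

/-- **Hardy's inequality**, with an unspecified finite constant. -/
theorem exists_lintegral_rpow_enorm_div_le {p : ℝ} (hp : 1 ≤ p) (hpE : p < finrank ℝ E) :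
    ∃ M : ℝ≥0∞, M ≠ ∞ ∧ ∀ {F : Type*} [NormedAddCommGroup F] [NormedSpace ℝ F] {f : E → F},
      ContDiff ℝ 1 f → HasCompactSupport f →
        ∫⁻ y, (‖f y‖ₑ / ‖y‖ₑ) ^ p ∂μ ≤ M * ∫⁻ y, ‖fderiv ℝ f y‖ₑ ^ p ∂μ := by
  obtain ⟨b, hb, hbp⟩ : ∃ b : ℝ, 1 < b ∧ b * (p - 1) < finrank ℝ E - 1 := by
    refine ⟨2 * (finrank ℝ E - 1) / (finrank ℝ E + p - 2), ?_, ?_⟩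
    · rw [lt_div_iff₀ (by linarith)]; linarith
    · rw [div_mul_eq_mul_div, div_lt_iff₀ (by linarith)]; nlinarith
  have hp0 : 0 < p := by linarith
  have : Nontrivial E := (finrank_pos_iff (R := ℝ)).1 (by exact_mod_cast hp0.trans hpE)
  set K := (∫⁻ t in Ioi (1 : ℝ), ENNReal.ofReal (t ^ (-b))) ^ (p - 1)
  set L := ∫⁻ t in Ioi (1 : ℝ), ENNReal.ofReal (t ^ (b * (p - 1) - finrank ℝ E))
  have hK : K ≠ ∞ := ENNReal.rpow_ne_top_of_nonneg (by linarith)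
    (lintegral_ofReal_rpow_Ioi_lt_top (by linarith)).ne
  have hL : L ≠ ∞ := (lintegral_ofReal_rpow_Ioi_lt_top (by linarith)).ne
  refine ⟨K * L, ENNReal.mul_ne_top hK hL, fun {F} _ _ f hf h'f => ?_⟩
  have hcont : Continuous (fderiv ℝ f) := hf.continuous_fderiv one_ne_zero
  have hG : Measurable fun y => ‖fderiv ℝ f y‖ₑ := hcont.enorm.measurable
  have hGt : Measurable fun z : E × ℝ => ‖fderiv ℝ f (z.2 • z.1)‖ₑ :=
    (hcont.comp (continuous_snd.smul continuous_fst)).enorm.measurable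
  have hwm : Measurable fun t : ℝ => ENNReal.ofReal (t ^ (-b)) := by fun_prop
  have hpoint : ∀ᵐ y ∂μ, (‖f y‖ₑ / ‖y‖ₑ) ^ p ≤
      K * ∫⁻ t in Ioi (1 : ℝ), ENNReal.ofReal (t ^ (-b)) ^ (1 - p) *
        ‖fderiv ℝ f (t • y)‖ₑ ^ p := by
    filter_upwards [Measure.ae_ne μ 0] with y hy
    have hGy : Measurable fun t : ℝ => ‖fderiv ℝ f (t • y)‖ₑ :=
      (hcont.comp (continuous_id.smul continuous_const)).enorm.measurable
    calc (‖f y‖ₑ / ‖y‖ₑ) ^ p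
        ≤ (∫⁻ t in Ioi (1 : ℝ), ‖fderiv ℝ f (t • y)‖ₑ) ^ p :=
          ENNReal.rpow_le_rpow (ENNReal.div_le_of_le_mul'
            (h'f.enorm_le_lintegral_fderiv_smul hf hy)) hp0.le
      _ ≤ _ := by
          refine ENNReal.rpow_lintegral_le_lintegral_weight_mul hp hwm
            hGy ?_ (.of_forall fun _ => ENNReal.ofReal_ne_top)
          filter_upwards [ae_restrict_mem measurableSet_Ioi] with t ht
          exact (ENNReal.ofReal_pos.2 (Real.rpow_pos_of_pos (one_pos.trans ht) _)).ne'
  calc ∫⁻ y, (‖f y‖ₑ / ‖y‖ₑ) ^ p ∂μ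
      ≤ ∫⁻ y, (K * ∫⁻ t in Ioi (1 : ℝ), ENNReal.ofReal (t ^ (-b)) ^ (1 - p) *
        ‖fderiv ℝ f (t • y)‖ₑ ^ p) ∂μ := lintegral_mono_ae hpoint
    _ = K * ∫⁻ t in Ioi (1 : ℝ), (∫⁻ y, ENNReal.ofReal (t ^ (-b)) ^ (1 - p) *
        ‖fderiv ℝ f (t • y)‖ₑ ^ p ∂μ) := by
      rw [lintegral_const_mul' _ _ hK, lintegral_lintegral_swap]
      exact (((hwm.comp measurable_snd).pow_const _).mul (hGt.pow_const p)).aemeasurable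
    _ = K * ∫⁻ t in Ioi (1 : ℝ), ENNReal.ofReal (t ^ (b * (p - 1) - finrank ℝ E)) *
        ∫⁻ y, ‖fderiv ℝ f y‖ₑ ^ p ∂μ := by
      congr 1
      refine setLIntegral_congr_fun measurableSet_Ioi fun t ht => ?_
      have ht0 : 0 < t := one_pos.trans ht
      have hpow : 0 < t ^ (-b) := Real.rpow_pos_of_pos ht0 _
      rw [ENNReal.ofReal_rpow_of_pos hpow, lintegral_const_mul' _ _ ENNReal.ofReal_ne_top,
        Measure.lintegral_addHaar_comp_smul μ (hG.pow_const p) ht0.ne', ← mul_assoc,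
        ← ENNReal.ofReal_mul (by positivity), abs_of_nonneg (by positivity),
        ← Real.rpow_mul ht0.le, ← Real.rpow_natCast, ← Real.rpow_neg ht0.le,
        ← Real.rpow_add ht0]
      ring_nf
    _ = K * L * ∫⁻ y, ‖fderiv ℝ f y‖ₑ ^ p ∂μ := by
      rw [lintegral_mul_const _ (by fun_prop), mul_assoc]

end

/-- Hardy-type inequality on `ℝ⁴` (Lemma 4.4 of the paper, Euclidean model case): for
`1 ≤ p < 4` there is a constant `C = C(p) > 0` such that for every smooth compactly supported
`f : ℝ⁴ → ℝ`,
`sup_x (∫ |x - y|⁻ᵖ |f y|ᵖ dy)^(1/p) ≤ C (‖∇f‖_{Lᵖ} + ‖f‖_{Lᵖ})`. -/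
theorem hardy_type_inequality_R4
    (p : ℝ) (hp : 1 ≤ p) (hp4 : p < 4) :
    ∃ C : ℝ, 0 < C ∧
      ∀ f : EuclideanSpace ℝ (Fin 4) → ℝ,
        ContDiff ℝ (⊤ : ℕ∞) f → HasCompactSupport f →
        ∀ x : EuclideanSpace ℝ (Fin 4),
          (∫ y, dist x y ^ (-p) * |f y| ^ p) ^ (1 / p) ≤
            C * ((∫ y, ‖fderiv ℝ f y‖ ^ p) ^ (1 / p) + (∫ y, |f y| ^ p) ^ (1 / p)) := by
  have hp0 : 0 < p := by linarith
  obtain ⟨M, hM, hardy⟩ := exists_lintegral_rpow_enorm_div_le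
    (volume : Measure (EuclideanSpace ℝ (Fin 4))) hp (by simpa using hp4)
  refine ⟨M.toReal ^ (1 / p) + 1, by positivity, fun f hf h'f x => ?_⟩
  have hf1 : ContDiff ℝ 1 f := hf.of_le (by exact_mod_cast le_top)
  have hcont : Continuous (fderiv ℝ f) := hf1.continuous_fderiv one_ne_zero
  have hint : Integrable fun y => ‖fderiv ℝ f y‖ ^ p :=
    (hcont.norm.rpow_const fun _ => .inr hp0.le).integrable_of_hasCompactSupport
      ((h'f.fderiv ℝ).norm.rpow_const hp0.ne')
  have hgrad : ∫⁻ y, ‖fderiv ℝ f y‖ₑ ^ p = ENNReal.ofReal (∫ y, ‖fderiv ℝ f y‖ ^ p) := by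
    rw [ofReal_integral_eq_lintegral_ofReal hint (.of_forall fun y => by positivity)]
    refine lintegral_congr fun y => ?_
    rw [← ENNReal.ofReal_rpow_of_nonneg (norm_nonneg _) hp0.le, ofReal_norm]
  have htrans : ∫⁻ y, (‖f y‖ₑ / ‖y - x‖ₑ) ^ p ≤ M * ∫⁻ y, ‖fderiv ℝ f y‖ₑ ^ p := by
    have h := hardy (f := fun y => f (y + x)) (hf1.comp (contDiff_id.add contDiff_const))
      (h'f.comp_homeomorph (Homeomorph.addRight x))
    simp only [fderiv_comp_add_right] at h
    rw [lintegral_add_right_eq_self (fun y => ‖fderiv ℝ f y‖ₑ ^ p) x] at h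
    rw [← lintegral_add_right_eq_self _ x]
    simpa using h
  have hmain : ∫ y, dist x y ^ (-p) * |f y| ^ p ≤ M.toReal * ∫ y, ‖fderiv ℝ f y‖ ^ p := by
    have hnn : ∀ y, 0 ≤ dist x y ^ (-p) * |f y| ^ p := fun y => by positivity
    have hmeas : Measurable fun y => dist x y ^ (-p) * |f y| ^ p := by
      have := hf1.continuous.measurable
      fun_prop
    rw [integral_eq_lintegral_of_nonneg_ae (.of_forall hnn) hmeas.aestronglyMeasurable]
    refine ENNReal.toReal_le_of_le_ofReal (by positivity) ?_
    rw [ENNReal.ofReal_mul ENNReal.toReal_nonneg, ENNReal.ofReal_toReal hM, ← hgrad]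
    refine le_trans (lintegral_mono_ae ?_) htrans
    filter_upwards [Measure.ae_ne volume x] with y hy
    have hd : 0 < dist x y := dist_pos.2 hy.symm
    rw [Real.rpow_neg hd.le, mul_comm, ← div_eq_mul_inv, ← Real.div_rpow (abs_nonneg _) hd.le,
      ← ENNReal.ofReal_rpow_of_nonneg (by positivity) hp0.le, ENNReal.ofReal_div_of_pos hd,
      dist_comm, dist_eq_norm, ofReal_norm, ← Real.norm_eq_abs, ofReal_norm]
  calc (∫ y, dist x y ^ (-p) * |f y| ^ p) ^ (1 / p)
      ≤ (M.toReal * ∫ y, ‖fderiv ℝ f y‖ ^ p) ^ (1 / p) :=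
        Real.rpow_le_rpow (integral_nonneg fun y => by positivity) hmain (by positivity)
    _ = M.toReal ^ (1 / p) * (∫ y, ‖fderiv ℝ f y‖ ^ p) ^ (1 / p) :=
        Real.mul_rpow ENNReal.toReal_nonneg (integral_nonneg fun y => by positivity)
    _ ≤ _ := by
        gcongr
        · simp
        · exact le_add_of_nonneg_right
            (Real.rpow_nonneg (integral_nonneg fun y => by positivity) _)
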